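/- arXiv:1211.3349 — 2 statements merged into one kernel-verified Lean document; each statement's English description precedes it below -/
import Mathlib

section
/- Let F be a field and suppose that for each w ∈ 𝔖_n a polynomial f_w ∈ F[x_1,…,x_n] is given of the form f_w = w·x_{D(w)} + ∑_d c_d x^d, where the (finite) sum runs over d ∈ ℕ^n with x^d ≺ x_{D(w)} and c_d ∈ F. Then {f_w : w ∈ 𝔖_n} is a free basis of F[x_1,…,x_n] as a module over the subring F[x]^{𝔖_n} of symmetric polynomials, and the images of the f_w form an F-vector-space basis of the coinvariant algebra F[x_1,…,x_n]/(F[x]^{𝔖_n}_+). (Lemma 4.3.) -/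
open MvPolynomial

/-- Value of a permutation of `Fin n` as a function `ℕ → ℕ` (0 outside range). -/
def pval {n : ℕ} (w : Equiv.Perm (Fin n)) (i : ℕ) : ℕ :=
  if h : i < n then (w ⟨i, h⟩ : ℕ) else 0

/-- 0-based descent set of `w`: `i ∈ permDes w` iff `w(i) > w(i+1)`, `0 ≤ i ≤ n-2`.
(This corresponds to the 1-based descent `i+1` of the paper.) -/
def permDes {n : ℕ} (w : Equiv.Perm (Fin n)) : Finset ℕ :=
  (Finset.range (n - 1)).filter fun i => pval w (i + 1) < pval w i

/-- Number of inversions = Coxeter length of `w`. -/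
def invNum {n : ℕ} (w : Equiv.Perm (Fin n)) : ℕ :=
  (Finset.univ.filter fun p : Fin n × Fin n => p.1 < p.2 ∧ w p.2 < w p.1).card

/-- The simple transposition `s_i = (i, i+1)` (0-based); identity if out of range. -/
def sw (n : ℕ) (i : ℕ) : Equiv.Perm (Fin n) :=
  if h : i + 1 < n then Equiv.swap ⟨i, Nat.lt_of_succ_lt h⟩ ⟨i + 1, h⟩ else 1

/-- Exponent vector of `x_I = ∏_{i ∈ I} (x_0 x_1 ⋯ x_i)`. -/
def expI (n : ℕ) (I : Finset ℕ) : Fin n → ℕ := fun j => (I.filter fun i => (j : ℕ) ≤ i).card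

/-- The monomial `x_I = ∏_{i ∈ I} (x_0 x_1 ⋯ x_i)`. -/
noncomputable def xI (R : Type*) [CommRing R] (n : ℕ) (I : Finset ℕ) :
    MvPolynomial (Fin n) R :=
  ∏ j : Fin n, (X j) ^ expI n I j

/-- `λ(d)`: the decreasing rearrangement of an exponent vector. -/
def lam {n : ℕ} (d : Fin n → ℕ) : List ℕ := (List.ofFn d).insertionSort (· ≥ ·)

/-- `x^d ≺ x^e` : `λ(d)` lexicographically smaller than `λ(e)`. -/
def monLT {n : ℕ} (d e : Fin n → ℕ) : Prop := List.Lex (· < ·) (lam d) (lam e)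

/-- 0-based descent set `D(α)` of a composition `α` of `n`:
`{α_1 + ⋯ + α_j - 1 : 1 ≤ j ≤ ℓ(α) - 1}` (0-based shift of the paper's `D(α)`). -/
def compDes {n : ℕ} (c : Composition n) : Finset ℕ :=
  (Finset.range (c.length - 1)).image fun j => c.sizeUpTo (j + 1) - 1

/-- The ideal of `F[x]` generated by the symmetric (`𝔖_n`-invariant) polynomials with zero
constant term; the coinvariant algebra is the quotient by this ideal. -/
noncomputable def coinvIdeal (n : ℕ) (F : Type*) [Field F] : Ideal (MvPolynomial (Fin n) F) :=
  Ideal.span {f : MvPolynomial (Fin n) F | f.IsSymmetric ∧ constantCoeff f = 0}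

section SortedExponents

variable {n : ℕ}

/-- The stable permutation sorting `d` into weakly decreasing order. -/
def decSort (d : Fin n → ℕ) : Equiv.Perm (Fin n) :=
  Tuple.sort (OrderDual.toDual ∘ d)

lemma antitone_comp_decSort (d : Fin n → ℕ) : Antitone (d ∘ decSort d) :=
  fun _ _ h => Tuple.monotone_sort (OrderDual.toDual ∘ d) h

lemma eq_decSort_iff {d : Fin n → ℕ} {σ : Equiv.Perm (Fin n)} :
    σ = decSort d ↔ Antitone (d ∘ σ) ∧ ∀ i j, i < j → d (σ i) = d (σ j) → σ i < σ j :=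
  Tuple.eq_sort_iff (f := OrderDual.toDual ∘ d)

/-- The decreasing rearrangement of `d`, in the lexicographic order on tuples. -/
def sortedLex (d : Fin n → ℕ) : Lex (Fin n → ℕ) := toLex (d ∘ decSort d)

lemma sortedLex_eq {d : Fin n → ℕ} {σ : Equiv.Perm (Fin n)} (h : Antitone (d ∘ σ)) :
    sortedLex d = toLex (d ∘ σ) :=
  congrArg toLex (Tuple.unique_antitone (antitone_comp_decSort d) h)

lemma sortedLex_comp_symm {ν : Fin n → ℕ} (h : Antitone ν) (w : Equiv.Perm (Fin n)) :
    sortedLex (ν ∘ w.symm) = toLex ν := by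
  have h' : (ν ∘ w.symm) ∘ w = ν := by ext; simp
  rw [sortedLex_eq (σ := w) (by rwa [h']), h']

lemma lam_eq_ofFn (d : Fin n → ℕ) : lam d = List.ofFn (ofLex (sortedLex d)) := by
  refine List.Perm.eq_of_sortedGE (List.sortedGE_insertionSort)
    (antitone_comp_decSort d).sortedGE_ofFn ?_
  exact (List.perm_insertionSort _ _).trans ((decSort d).ofFn_comp_perm d).symm

lemma ofFn_lex_ofFn_iff {a b : Fin n → ℕ} :
    List.Lex (· < ·) (List.ofFn a) (List.ofFn b) ↔ toLex a < toLex b := by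
  rw [List.lex_lt, List.lt_iff_exists]
  simp only [List.length_ofFn, lt_irrefl, and_false, false_or, List.getElem_ofFn]
  constructor
  · rintro ⟨i, hi, _, h, h'⟩
    exact ⟨⟨i, hi⟩, fun j hj => h j hj, h'⟩
  · rintro ⟨i, h, h'⟩
    exact ⟨i, i.2, i.2, fun j hj => h ⟨j, hj.trans i.2⟩ hj, h'⟩

lemma monLT_iff (d e : Fin n → ℕ) : monLT d e ↔ sortedLex d < sortedLex e := by
  rw [monLT, lam_eq_ofFn, lam_eq_ofFn, ofFn_lex_ofFn_iff]; rfl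

/-- At the first place of a level set of `e` where a rearrangement of the decreasing tuple `ν`
preserving the level sets of `e` differs from `ν`, the rearrangement is smaller. -/
lemma apply_perm_le_of_antitone {ν : Fin n → ℕ} (hν : Antitone ν) {e : Fin n → ℕ}
    {τ : Equiv.Perm (Fin n)} (hτ : ∀ i, e (τ i) = e i) (i : Fin n)
    (h : ∀ j < i, e j = e i → ν (τ j) = ν j) : ν (τ i) ≤ ν i := by
  by_contra! hlt
  let A : Finset (Fin n) := {j | e j = e i ∧ ν (τ i) ≤ ν j}
  let B : Finset (Fin n) := {j | e j = e i ∧ ν (τ i) ≤ ν (τ j)}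
  have hA : ∀ j ∈ A, j < i := by
    intro j hj
    by_contra! hij
    have := hν hij
    simp only [A, Finset.mem_filter] at hj
    omega
  have hi : i ∉ A := fun hi => lt_irrefl _ (hA i hi)
  have hsub : insert i A ⊆ B := by
    intro j hj
    rcases Finset.mem_insert.1 hj with rfl | hj
    · simp [B]
    · have h1 := h j (hA j hj)
      simp only [A, B, Finset.mem_filter, Finset.mem_univ, true_and] at hj ⊢
      exact ⟨hj.1, by rw [h1 hj.1]; exact hj.2⟩
  have hcard : B.card ≤ A.card := by
    refine Finset.card_le_card_of_injOn τ ?_ τ.injective.injOn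
    intro j hj
    simp only [A, B, Finset.coe_filter, Finset.mem_univ, true_and, Set.mem_ofPred_eq] at hj ⊢
    rwa [hτ]
  have := Finset.card_le_card hsub
  rw [Finset.card_insert_of_notMem hi] at this
  omega

lemma le_sortedLex (d : Fin n → ℕ) (σ : Equiv.Perm (Fin n)) : toLex (d ∘ σ) ≤ sortedLex d := by
  by_contra! hlt
  obtain ⟨i, h, h'⟩ := hlt
  refine absurd (apply_perm_le_of_antitone (antitone_comp_decSort d) (e := 0)
    (τ := σ.trans (decSort d).symm) (fun _ => rfl) i fun j hj _ => ?_) (not_le.2 ?_)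
  · simpa [sortedLex] using (h j hj).symm
  · simpa [sortedLex] using h'

lemma sortedLex_add_le (a b : Fin n → ℕ) : sortedLex (a + b) ≤ sortedLex a + sortedLex b := by
  have : sortedLex (a + b) = toLex (a ∘ decSort (a + b)) + toLex (b ∘ decSort (a + b)) := rfl
  rw [this]
  exact add_le_add (le_sortedLex _ _) (le_sortedLex _ _)

/-- The linear order refining `≺` used to compare exponent vectors: first by decreasing
rearrangement, then lexicographically. -/
def expKey (d : Fin n → ℕ) : Lex (Fin n → ℕ) ×ₗ Lex (Fin n → ℕ) :=
  toLex (sortedLex d, toLex d)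

lemma expKey_injective : Function.Injective (expKey (n := n)) := fun _ _ h =>
  congrArg Prod.snd h

lemma expKey_add_le {e μ a b : Fin n → ℕ} {w : Equiv.Perm (Fin n)} (he : Antitone e)
    (hμ : Antitone μ) (hw : ∀ i j, i < j → e i = e j → w i < w j)
    (ha : sortedLex a ≤ toLex μ) (hb : sortedLex b < toLex e ∨ b = e ∘ w.symm) :
    expKey (a + b) ≤ expKey ((μ + e) ∘ w.symm) := by
  have hs : sortedLex ((μ + e) ∘ w.symm) = toLex μ + toLex e :=
    sortedLex_comp_symm (hμ.add he) w
  rw [expKey, expKey, Prod.Lex.toLex_le_toLex, hs]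
  rcases hb with hb | rfl
  · exact Or.inl ((sortedLex_add_le a b).trans_lt (add_lt_add_of_le_of_lt ha hb))
  have hb : sortedLex (e ∘ w.symm) = toLex e := sortedLex_comp_symm he w
  set b := e ∘ w.symm with hb'
  rcases ((sortedLex_add_le a b).trans (add_le_add ha hb.le)).lt_or_eq with h | h
  · exact Or.inl h
  refine Or.inr ⟨h, ?_⟩
  set ρ := decSort (a + b) with hρ
  have h0 : toLex (a ∘ ρ) + toLex (b ∘ ρ) = toLex μ + toLex e := h
  have h1 : toLex (a ∘ ρ) ≤ toLex μ := (le_sortedLex _ _).trans ha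
  have h2 : toLex (b ∘ ρ) ≤ toLex e := (le_sortedLex _ _).trans hb.le
  obtain ⟨h3, h4⟩ := (add_eq_add_iff_eq_and_eq h1 h2).1 h0
  have haρ : ∀ i, a (ρ i) = μ i := fun i => congrFun h3 i
  have hbρ : ∀ i, e (w.symm (ρ i)) = e i := fun i => congrFun h4 i
  by_contra! hlt
  obtain ⟨p, hp, hp'⟩ := hlt
  refine absurd (apply_perm_le_of_antitone hμ (e := e) (τ := w.trans ρ.symm) (fun i => ?_)
    (w.symm p) fun j hj hej => ?_) (not_le.2 ?_)
  · have := hbρ (ρ.symm (w i))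
    simpa using this.symm
  · have h5 := hw _ _ hj hej
    rw [Equiv.apply_symm_apply] at h5
    have h6 := hp _ h5
    have h7 := haρ (ρ.symm (w j))
    simp [hb'] at h6 h7 ⊢
    omega
  · have h7 := haρ (ρ.symm p)
    simp [hb'] at hp' h7 ⊢
    omega

end SortedExponents

section Descents

variable {n : ℕ}

lemma pval_coe (w : Equiv.Perm (Fin n)) (i : Fin n) : pval w i = w i := by
  simp [pval]

lemma mem_permDes {w : Equiv.Perm (Fin n)} {i : ℕ} :
    i ∈ permDes w ↔ i < n - 1 ∧ pval w (i + 1) < pval w i := by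
  simp [permDes]

lemma antitone_expI (I : Finset ℕ) : Antitone (expI n I) := fun i j hij =>
  Finset.card_le_card fun k hk => by
    simp only [Finset.mem_filter] at hk ⊢
    exact ⟨hk.1, le_trans hij hk.2⟩

lemma lt_of_expI_eq {w : Equiv.Perm (Fin n)} {i j : Fin n} (hij : i < j)
    (h : expI n (permDes w) i = expI n (permDes w) j) : w i < w j := by
  have hsub : ((permDes w).filter fun k => (j : ℕ) ≤ k) ⊆
      (permDes w).filter fun k => (i : ℕ) ≤ k := fun k hk => by
    simp only [Finset.mem_filter] at hk ⊢
    exact ⟨hk.1, le_trans hij.le hk.2⟩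
  have heq := Finset.eq_of_subset_of_card_le hsub h.le
  have hdes : ∀ k, (i : ℕ) ≤ k → k < j → k ∉ permDes w := fun k hik hkj hk => by
    have : k ∈ (permDes w).filter fun k => (j : ℕ) ≤ k := by
      rw [heq]; exact Finset.mem_filter.2 ⟨hk, hik⟩
    exact absurd (Finset.mem_filter.1 this).2 (not_le.2 hkj)
  have step : ∀ k, (i : ℕ) ≤ k → k < j → pval w k < pval w (k + 1) := fun k hik hkj => by
    have h1 := hdes k hik hkj
    have hj := j.2
    rw [mem_permDes, not_and, not_lt] at h1
    refine lt_of_le_of_ne (h1 (by omega)) fun h2 => ?_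
    have := (pval_coe w ⟨k, by omega⟩).symm.trans (h2.trans (pval_coe w ⟨k + 1, by omega⟩))
    have := w.injective (Fin.ext this)
    simp at this
  have key : ∀ k : ℕ, (i : ℕ) + 1 ≤ k → k ≤ j → pval w i < pval w k := by
    intro k hk
    induction k, hk using Nat.le_induction with
    | base => exact fun h => step _ le_rfl h
    | succ k hk ih => exact fun h => (ih (by omega)).trans (step k (by omega) (by omega))
  have := key j hij le_rfl
  rwa [pval_coe, pval_coe] at this

lemma expI_apply_eq_succ_add_ite (w : Equiv.Perm (Fin n)) (i j : Fin n) (hij : (j : ℕ) = i + 1) :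
    expI n (permDes w) i = expI n (permDes w) j + if w j < w i then 1 else 0 := by
  have h1 : ((permDes w).filter fun k => (i : ℕ) ≤ k) =
      ((permDes w).filter fun k => (j : ℕ) ≤ k) ∪ (permDes w).filter fun k => k = i := by
    ext k; simp only [Finset.mem_filter, Finset.mem_union]
    constructor
    · rintro ⟨h, h'⟩
      rcases h'.eq_or_lt with h' | h'
      · exact Or.inr ⟨h, h'.symm⟩
      · exact Or.inl ⟨h, by omega⟩
    · rintro (⟨h, h'⟩ | ⟨h, h'⟩) <;> exact ⟨h, by omega⟩
  have hd : Disjoint ((permDes w).filter fun k => (j : ℕ) ≤ k)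
      ((permDes w).filter fun k => k = i) := by
    rw [Finset.disjoint_filter]; intros; omega
  have hi : (i : ℕ) ∈ permDes w ↔ w j < w i := by
    rw [mem_permDes, ← hij, pval_coe, pval_coe, Fin.lt_def]
    have := j.2
    exact and_iff_right (by omega)
  rw [expI, expI, h1, Finset.card_union_of_disjoint hd, Finset.filter_eq']
  simp only [hi]
  split_ifs <;> rfl

/-- Every exponent vector is the sum of the exponent vector of a descent monomial `w ⬝ x_{D(w)}`
and of `w` applied to a partition. -/
lemma exists_antitone_add_expI (d : Fin n → ℕ) : ∃ (w : Equiv.Perm (Fin n)) (μ : Fin n → ℕ),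
    Antitone μ ∧ d = (μ + expI n (permDes w)) ∘ w.symm := by
  set w := decSort d with hw
  obtain ⟨hanti, htie⟩ := eq_decSort_iff.1 hw
  set e := expI n (permDes w) with he
  have step : ∀ i j : Fin n, (j : ℕ) = i + 1 → d (w j) + e i ≤ d (w i) + e j := by
    intro i j hij
    have hlt : i < j := Fin.lt_def.2 (by omega)
    have h1 : d (w j) ≤ d (w i) := hanti hlt.le
    have h2 := htie i j hlt
    have h3 := expI_apply_eq_succ_add_ite w i j hij
    rw [← he] at h3
    split_ifs at h3 with h
    · have : d (w i) ≠ d (w j) := fun h4 => absurd (h2 h4) (not_lt.2 h.le)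
      omega
    · omega
  have hle : ∀ i, e i ≤ d (w i) ∧ ∀ j, i ≤ j → d (w j) + e i ≤ d (w i) + e j := by
    have : ∀ k : ℕ, ∀ i : Fin n, (i : ℕ) + k + 1 = n →
        e i ≤ d (w i) ∧ ∀ j, i ≤ j → d (w j) + e i ≤ d (w i) + e j := by
      intro k
      induction k with
      | zero =>
        intro i hi
        constructor
        · have : e i = 0 := by
            rw [he, expI, Finset.card_eq_zero, Finset.filter_eq_empty_iff]
            intro k hk
            have := (mem_permDes.1 hk).1
            omega
          omega
        · intro j hij
          obtain rfl : i = j := Fin.ext (by have := Fin.le_def.1 hij; omega)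
          exact le_rfl
      | succ k ih =>
        intro i hi
        obtain ⟨h1, h2⟩ := ih ⟨i + 1, by omega⟩ (by simp; omega)
        have h3 := step i ⟨i + 1, by omega⟩ rfl
        refine ⟨by omega, fun j hij => ?_⟩
        rcases hij.eq_or_lt with rfl | hij
        · exact le_rfl
        · have := h2 j (Fin.le_def.2 (Nat.succ_le_of_lt hij))
          omega
    exact fun i => this (n - 1 - i) i (by omega)
  refine ⟨w, fun i => d (w i) - e i, fun i j hij => ?_, ?_⟩
  · have h1 := (hle i).2 j hij
    have h2 := (hle i).1
    have h3 := (hle j).1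
    simp only
    omega
  · ext i
    have : e (w.symm i) ≤ d i := by simpa using (hle (w.symm i)).1
    simp only [Function.comp_apply, Pi.add_apply, Equiv.apply_symm_apply, ← he]
    omega

lemma eq_decSort_add_expI {w : Equiv.Perm (Fin n)} {μ : Fin n → ℕ} (hμ : Antitone μ) :
    w = decSort ((μ + expI n (permDes w)) ∘ w.symm) := by
  have h : ((μ + expI n (permDes w)) ∘ w.symm) ∘ w = μ + expI n (permDes w) := by ext; simp
  rw [eq_decSort_iff, h]
  refine ⟨hμ.add (antitone_expI _), fun i j hij hd => lt_of_expI_eq hij ?_⟩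
  have h1 := hμ hij.le
  have h2 := antitone_expI (n := n) (permDes w) hij.le
  simp at hd
  omega

end Descents

section LeadingTerms

variable {n : ℕ} {F : Type*} [Field F]

lemma mapDomain_equivFunOnFinite_symm (d : Fin n → ℕ) (w : Equiv.Perm (Fin n)) :
    (Finsupp.equivFunOnFinite.symm d).mapDomain w =
      Finsupp.equivFunOnFinite.symm (d ∘ w.symm) := by
  ext i; simp [Finsupp.mapDomain_equiv_apply]

lemma MvPolynomial.IsSymmetric.coeff_comp_symm {s : MvPolynomial (Fin n) F} (hs : s.IsSymmetric)
    (d : Fin n → ℕ) (w : Equiv.Perm (Fin n)) :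
    s.coeff (Finsupp.equivFunOnFinite.symm (d ∘ w.symm)) =
      s.coeff (Finsupp.equivFunOnFinite.symm d) := by
  rw [← mapDomain_equivFunOnFinite_symm]
  conv_lhs => rw [← hs w]
  exact coeff_rename_mapDomain w w.injective s _

/-- The sum of the distinct monomials in the `𝔖_n`-orbit of `x^μ`. -/
noncomputable def orbitSum (F : Type*) [Field F] (μ : Fin n → ℕ) : MvPolynomial (Fin n) F :=
  ∑ d ∈ Finset.univ.image fun σ : Equiv.Perm (Fin n) =>
    Finsupp.equivFunOnFinite.symm (μ ∘ σ), monomial d 1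

lemma isSymmetric_orbitSum (μ : Fin n → ℕ) : (orbitSum F μ).IsSymmetric := by
  intro e
  rw [orbitSum, map_sum]
  simp only [rename_monomial]
  refine Finset.sum_nbij (fun d => d.mapDomain e) ?_ ?_ ?_ fun _ _ => rfl
  · intro d hd
    obtain ⟨σ, -, rfl⟩ := Finset.mem_image.1 hd
    exact Finset.mem_image.2 ⟨e.symm.trans σ, Finset.mem_univ _,
      (mapDomain_equivFunOnFinite_symm (μ ∘ σ) e).symm⟩
  · exact (Finsupp.mapDomain_injective e.injective).injOn
  · intro d hd
    obtain ⟨σ, -, rfl⟩ := Finset.mem_image.1 hd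
    refine ⟨Finsupp.equivFunOnFinite.symm (μ ∘ e.trans σ), Finset.mem_coe.2
      (Finset.mem_image.2 ⟨e.trans σ, Finset.mem_univ _, rfl⟩), ?_⟩
    dsimp only
    rw [mapDomain_equivFunOnFinite_symm]
    congr 1; ext i; simp

lemma coeff_orbitSum_self (μ : Fin n → ℕ) :
    (orbitSum F μ).coeff (Finsupp.equivFunOnFinite.symm μ) = 1 := by
  rw [orbitSum, coeff_sum]
  simp only [coeff_monomial]
  rw [Finset.sum_ite_eq', if_pos]
  exact Finset.mem_image.2 ⟨1, Finset.mem_univ _, rfl⟩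

lemma sortedLex_of_mem_support_orbitSum {μ : Fin n → ℕ} (hμ : Antitone μ) {d : Fin n →₀ ℕ}
    (hd : d ∈ (orbitSum F μ).support) : sortedLex d = toLex μ := by
  rw [mem_support_iff, orbitSum, coeff_sum] at hd
  simp only [coeff_monomial] at hd
  rw [Finset.sum_ite_eq', ite_ne_right_iff] at hd
  obtain ⟨σ, -, rfl⟩ := Finset.mem_image.1 hd.1
  exact sortedLex_comp_symm hμ σ.symm

/-- `p = w ⬝ x_{D(w)} + (lower terms in ≺)`. -/
def HasDescentLead (w : Equiv.Perm (Fin n)) (p : MvPolynomial (Fin n) F) : Prop :=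
  ∃ g : MvPolynomial (Fin n) F, p = rename w (xI F n (permDes w)) + g ∧
    ∀ d ∈ g.support, monLT (⇑d) (expI n (permDes w))

lemma rename_xI (w : Equiv.Perm (Fin n)) (I : Finset ℕ) :
    rename w (xI F n I) =
      monomial (Finsupp.equivFunOnFinite.symm (expI n I ∘ w.symm)) 1 := by
  have : xI F n I = monomial (Finsupp.equivFunOnFinite.symm (expI n I)) 1 := by
    rw [monomial_eq, Finsupp.prod_fintype _ _ (by simp), xI]
    simp
  rw [this, rename_monomial, mapDomain_equivFunOnFinite_symm]

lemma sortedLex_expI (I : Finset ℕ) : sortedLex (expI n I) = toLex (expI n I) :=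
  sortedLex_comp_symm (antitone_expI I) 1

namespace HasDescentLead

variable {w : Equiv.Perm (Fin n)} {p : MvPolynomial (Fin n) F}

lemma lt_or_eq_of_mem_support (hp : HasDescentLead w p) {d : Fin n →₀ ℕ} (hd : d ∈ p.support) :
    sortedLex d < toLex (expI n (permDes w)) ∨ ⇑d = expI n (permDes w) ∘ w.symm := by
  obtain ⟨g, rfl, hg⟩ := hp
  rw [rename_xI] at hd
  rcases Finset.mem_union.1 (support_add hd) with h | h
  · right
    rw [Finset.mem_singleton.1 (support_monomial_subset h)]
    rfl
  · left
    rw [← sortedLex_expI, ← monLT_iff]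
    exact hg d h

lemma coeff_lead (hp : HasDescentLead w p) :
    p.coeff (Finsupp.equivFunOnFinite.symm (expI n (permDes w) ∘ w.symm)) = 1 := by
  obtain ⟨g, rfl, hg⟩ := hp
  rw [rename_xI, coeff_add, coeff_monomial, if_pos rfl, add_eq_left]
  by_contra h
  have := (monLT_iff _ _).1 (hg _ (mem_support_iff.2 h))
  rw [sortedLex_expI, Finsupp.coe_equivFunOnFinite_symm] at this
  exact this.ne (sortedLex_comp_symm (antitone_expI _) w)

variable {s : MvPolynomial (Fin n) F} {μ : Fin n → ℕ}

lemma expKey_le_of_mem_support_mul (hp : HasDescentLead w p) (hμ : Antitone μ)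
    (hs : ∀ a ∈ s.support, sortedLex a ≤ toLex μ) {d : Fin n →₀ ℕ} (hd : d ∈ (s * p).support) :
    expKey d ≤ expKey ((μ + expI n (permDes w)) ∘ w.symm) := by
  classical
  obtain ⟨a, ha, b, hb, rfl⟩ := Finset.mem_add.1 (support_mul _ _ hd)
  exact expKey_add_le (antitone_expI _) hμ (fun _ _ => lt_of_expI_eq) (hs a ha)
    (hp.lt_or_eq_of_mem_support hb)

lemma coeff_mul_lead (hp : HasDescentLead w p) (hμ : Antitone μ) (hsymm : s.IsSymmetric)
    (hs : ∀ a ∈ s.support, sortedLex a ≤ toLex μ) :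
    (s * p).coeff (Finsupp.equivFunOnFinite.symm ((μ + expI n (permDes w)) ∘ w.symm)) =
      s.coeff (Finsupp.equivFunOnFinite.symm μ) := by
  classical
  rw [coeff_mul, Finset.sum_eq_single (Finsupp.equivFunOnFinite.symm (μ ∘ w.symm),
    Finsupp.equivFunOnFinite.symm (expI n (permDes w) ∘ w.symm)), hp.coeff_lead, mul_one,
    hsymm.coeff_comp_symm]
  · rintro ⟨a, b⟩ hab hne
    by_contra h
    have hab' : (a + b : Fin n → ℕ) = (μ + expI n (permDes w)) ∘ w.symm :=
      congrArg DFunLike.coe (Finset.HasAntidiagonal.mem_antidiagonal.1 hab)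
    have ha := hs a (mem_support_iff.2 (left_ne_zero_of_mul h))
    have hb := hp.lt_or_eq_of_mem_support (mem_support_iff.2 (right_ne_zero_of_mul h))
    rcases hb with hb | hb
    · have h1 := (sortedLex_add_le a b).trans_lt (add_lt_add_of_le_of_lt ha hb)
      rw [hab'] at h1
      exact h1.ne (sortedLex_comp_symm (hμ.add (antitone_expI _)) w)
    · refine hne (Prod.ext (DFunLike.coe_injective ?_) (DFunLike.coe_injective hb))
      rw [hb] at hab'
      exact add_right_cancel hab'
  · intro h
    exact absurd (Finset.HasAntidiagonal.mem_antidiagonal.2 (by ext; simp)) h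

end HasDescentLead

lemma exists_antitone_lead {s : MvPolynomial (Fin n) F} (hsymm : s.IsSymmetric) (h0 : s ≠ 0) :
    ∃ μ : Fin n → ℕ, Antitone μ ∧ (∀ a ∈ s.support, sortedLex a ≤ toLex μ) ∧
      s.coeff (Finsupp.equivFunOnFinite.symm μ) ≠ 0 := by
  obtain ⟨a, ha, hmax⟩ := s.support.exists_max_image (fun a => sortedLex a)
    (support_nonempty.2 h0)
  refine ⟨a ∘ decSort a, antitone_comp_decSort a, hmax, ?_⟩
  have := hsymm.coeff_comp_symm a (decSort a).symm
  rw [Equiv.symm_symm] at this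
  rw [this, Finsupp.equivFunOnFinite_symm_coe]
  exact mem_support_iff.1 ha

variable {f : Equiv.Perm (Fin n) → MvPolynomial (Fin n) F}

theorem linearIndependent_of_hasDescentLead (hf : ∀ w, HasDescentLead w (f w)) :
    LinearIndependent (symmetricSubalgebra (Fin n) F) f := by
  classical
  rw [Fintype.linearIndependent_iff]
  intro s hsum
  by_contra! hne
  have hlead : ∀ w, ∃ μ : Fin n → ℕ, s w ≠ 0 → Antitone μ ∧
      (∀ a ∈ (s w).1.support, sortedLex a ≤ toLex μ) ∧
      (s w).1.coeff (Finsupp.equivFunOnFinite.symm μ) ≠ 0 := fun w => by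
    by_cases h : s w = 0
    · exact ⟨0, fun h' => absurd h h'⟩
    · obtain ⟨μ, hμ⟩ := exists_antitone_lead (s w).2 fun h' => h (Subtype.ext h')
      exact ⟨μ, fun _ => hμ⟩
  choose μ hμ using hlead
  obtain ⟨w, hw, hmax⟩ := (Finset.univ.filter fun w => s w ≠ 0).exists_max_image
    (fun w => expKey ((μ w + expI n (permDes w)) ∘ w.symm))
    (hne.imp fun w hw => Finset.mem_filter.2 ⟨Finset.mem_univ _, hw⟩)
  rw [Finset.mem_filter] at hw
  obtain ⟨hanti, hle, hcoeff⟩ := hμ w hw.2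
  apply hcoeff
  rw [← (hf w).coeff_mul_lead hanti (s w).2 hle]
  have := congrArg
    (coeff (Finsupp.equivFunOnFinite.symm ((μ w + expI n (permDes w)) ∘ w.symm))) hsum
  rw [coeff_sum, Finset.sum_eq_single w, coeff_zero] at this
  · exact this
  · intro v _ hv
    by_contra h
    have hv0 : s v ≠ 0 := fun h0 => h (by rw [h0, zero_smul, coeff_zero])
    obtain ⟨hanti', hle', -⟩ := hμ v hv0
    have h1 := (hf v).expKey_le_of_mem_support_mul hanti' hle' (mem_support_iff.2 h)
    have h2 := expKey_injective (h1.antisymm (hmax v (by simpa using hv0)))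
    apply hv
    rw [eq_decSort_add_expI (w := v) hanti', eq_decSort_add_expI (w := w) hanti, ← h2]
    rfl
  · simp

theorem span_eq_top_of_hasDescentLead (hf : ∀ w, HasDescentLead w (f w)) :
    Submodule.span (symmetricSubalgebra (Fin n) F) (Set.range f) = ⊤ := by
  set M := Submodule.span (symmetricSubalgebra (Fin n) F) (Set.range f) with hM
  have hsmul : ∀ (c : F) {p : MvPolynomial (Fin n) F}, p ∈ M → C c * p ∈ M := fun c p hp =>
    M.smul_mem (⟨C c, IsSymmetric.C c⟩ : symmetricSubalgebra (Fin n) F) hp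
  have hmono : ∀ d : Fin n →₀ ℕ, monomial d (1 : F) ∈ M := by
    intro d
    induction d using (InvImage.wf (fun d : Fin n →₀ ℕ => expKey d) wellFounded_lt).induction with
    | h d ih =>
    obtain ⟨w, μ, hμ, hd⟩ := exists_antitone_add_expI d
    have hs : ∀ a ∈ (orbitSum F μ).support, sortedLex a ≤ toLex μ := fun a ha =>
      (sortedLex_of_mem_support_orbitSum hμ ha).le
    set p := orbitSum F μ * f w with hp
    have hpM : p ∈ M := M.smul_mem
      (⟨orbitSum F μ, isSymmetric_orbitSum μ⟩ : symmetricSubalgebra (Fin n) F)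
      (Submodule.subset_span ⟨w, rfl⟩)
    have hd' : Finsupp.equivFunOnFinite.symm ((μ + expI n (permDes w)) ∘ w.symm) = d :=
      DFunLike.coe_injective hd.symm
    have hcoeff : p.coeff d = 1 := by
      have := (hf w).coeff_mul_lead hμ (isSymmetric_orbitSum μ) hs
      rwa [hd', coeff_orbitSum_self] at this
    have hmem : d ∈ p.support := by rw [mem_support_iff, hcoeff]; exact one_ne_zero
    have hsum := p.as_sum
    rw [← Finset.add_sum_erase _ _ hmem, hcoeff] at hsum
    rw [eq_sub_of_add_eq hsum.symm]
    refine M.sub_mem hpM (M.sum_mem fun b hb => ?_)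
    rw [Finset.mem_erase] at hb
    have hle := (hf w).expKey_le_of_mem_support_mul hμ hs hb.2
    rw [← hd] at hle
    have := hsmul (p.coeff b) (ih b (hle.lt_of_ne fun h =>
      hb.1 (DFunLike.coe_injective (expKey_injective h))))
    rwa [C_mul_monomial, mul_one] at this
  rw [eq_top_iff]
  intro p _
  rw [p.as_sum]
  refine M.sum_mem fun d _ => ?_
  have := hsmul (p.coeff d) (hmono d)
  rwa [C_mul_monomial, mul_one] at this

end LeadingTerms

section Coinvariants

variable {n : ℕ} {F : Type*} [Field F] {ι : Type*}

lemma constantCoeff_repr_eq_zero_of_mem_coinvIdeal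
    (b : Module.Basis ι (symmetricSubalgebra (Fin n) F) (MvPolynomial (Fin n) F))
    {p : MvPolynomial (Fin n) F} (hp : p ∈ coinvIdeal n F) (i : ι) :
    constantCoeff (b.repr p i).1 = 0 := by
  have key : ∀ q : MvPolynomial (Fin n) F, constantCoeff (b.repr (q * p) i).1 = 0 := by
    induction hp using Submodule.span_induction with
    | mem a ha =>
      intro q
      have : q * a = (⟨a, ha.1⟩ : symmetricSubalgebra (Fin n) F) • q := mul_comm q a
      rw [this, map_smul, Finsupp.smul_apply]
      exact (map_mul constantCoeff _ _).trans (by rw [ha.2, zero_mul])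
    | zero => simp
    | add a a' _ _ h h' =>
      intro q
      rw [mul_add, map_add, Finsupp.add_apply]
      exact (map_add constantCoeff _ _).trans (by rw [h, h', add_zero])
    | smul r a _ h =>
      intro q
      rw [smul_eq_mul, ← mul_assoc]
      exact h _
  simpa using key 1

lemma mk_smul_eq (s : symmetricSubalgebra (Fin n) F) (p : MvPolynomial (Fin n) F) :
    Ideal.Quotient.mk (coinvIdeal n F) (s • p) =
      constantCoeff s.1 • Ideal.Quotient.mk (coinvIdeal n F) p := by
  have h : Ideal.Quotient.mk (coinvIdeal n F) s.1 =
      Ideal.Quotient.mk (coinvIdeal n F) (C (constantCoeff s.1)) := by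
    rw [Ideal.Quotient.eq]
    refine Ideal.subset_span ⟨?_, by simp⟩
    exact IsSymmetric.sub s.2 (IsSymmetric.C _)
  have h' : s • p = s.1 * p := rfl
  rw [h', map_mul, h, ← map_mul, ← smul_eq_C_mul]
  rfl

lemma linearIndependent_mk_coinvIdeal [Fintype ι] {f : ι → MvPolynomial (Fin n) F}
    (hli : LinearIndependent (symmetricSubalgebra (Fin n) F) f)
    (hsp : Submodule.span (symmetricSubalgebra (Fin n) F) (Set.range f) = ⊤) :
    LinearIndependent F fun i => Ideal.Quotient.mk (coinvIdeal n F) (f i) := by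
  rw [Fintype.linearIndependent_iff]
  intro c hc i
  set b := Module.Basis.mk hli hsp.ge with hb
  let s : ι → symmetricSubalgebra (Fin n) F := fun j => ⟨C (c j), IsSymmetric.C _⟩
  have hmem : ∑ j, s j • f j ∈ coinvIdeal n F := by
    rw [← Ideal.Quotient.eq_zero_iff_mem, map_sum, ← hc]
    refine Finset.sum_congr rfl fun j _ => ?_
    rw [mk_smul_eq]
    simp [s]
  have h := constantCoeff_repr_eq_zero_of_mem_coinvIdeal b hmem i
  have hrepr : b.repr (∑ j, s j • f j) i = s i := by
    have : ∑ j, s j • f j = ∑ j, s j • b j := by simp [hb]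
    rw [this, b.repr_sum_self]
  rw [hrepr] at h
  simpa [s] using h

lemma span_mk_coinvIdeal_eq_top {f : ι → MvPolynomial (Fin n) F}
    (hsp : Submodule.span (symmetricSubalgebra (Fin n) F) (Set.range f) = ⊤) :
    Submodule.span F (Set.range fun i => Ideal.Quotient.mk (coinvIdeal n F) (f i)) = ⊤ := by
  rw [eq_top_iff]
  intro x _
  obtain ⟨p, rfl⟩ := Ideal.Quotient.mk_surjective x
  have hp : p ∈ Submodule.span (symmetricSubalgebra (Fin n) F) (Set.range f) := hsp ▸ trivial
  induction hp using Submodule.span_induction with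
  | mem a ha =>
    obtain ⟨i, rfl⟩ := ha
    exact Submodule.subset_span ⟨i, rfl⟩
  | zero => rw [map_zero]; exact zero_mem _
  | add a a' _ _ h h' => rw [map_add]; exact add_mem (h trivial) (h' trivial)
  | smul s a _ h => rw [mk_smul_eq]; exact Submodule.smul_mem _ _ (h trivial)

end Coinvariants

/-- **Lemma 4.3.**  If each `f_w = w ⬝ x_{D(w)} + (lower terms in ≺)`, then `{f_w}` is a free
basis of `F[x]` over the symmetric polynomials, and the images of the `f_w` form an `F`-basis
of the coinvariant algebra. -/
theorem stmt_3 (n : ℕ) (hn : 1 ≤ n) (F : Type*) [Field F]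
    (f : Equiv.Perm (Fin n) → MvPolynomial (Fin n) F)
    (hf : ∀ w : Equiv.Perm (Fin n), ∃ g : MvPolynomial (Fin n) F,
      f w = rename w (xI F n (permDes w)) + g ∧
      ∀ d ∈ g.support, monLT (⇑d) (expI n (permDes w))) :
    (LinearIndependent (symmetricSubalgebra (Fin n) F) f ∧
      Submodule.span (symmetricSubalgebra (Fin n) F) (Set.range f) = ⊤) ∧
    (LinearIndependent F (fun w => Ideal.Quotient.mk (coinvIdeal n F) (f w)) ∧
      Submodule.span F
        (Set.range fun w => Ideal.Quotient.mk (coinvIdeal n F) (f w)) = ⊤) := by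
  have hli := linearIndependent_of_hasDescentLead hf
  have hsp := span_eq_top_of_hasDescentLead hf
  exact ⟨⟨hli, hsp⟩, linearIndependent_mk_coinvIdeal hli hsp, span_mk_coinvIdeal_eq_top hsp⟩
end

section
/- Let F be a field. The images of the Demazure atoms π̄_w(x_{D(w)}), for w ∈ 𝔖_n, form an F-vector-space basis of the coinvariant algebra F[x_1,…,x_n]/(F[x]^{𝔖_n}_+). (Part of Theorem 4.4.) -/
open MvPolynomial

theorem X_sub_X_ne_zero {σ F : Type*} [CommRing F] [Nontrivial F] {i j : σ} (hij : i ≠ j) :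
    (X i - X j : MvPolynomial σ F) ≠ 0 :=
  sub_ne_zero.2 (X_injective.ne hij)

theorem mapDomain_swap_of_eq {σ : Type*} [DecidableEq σ] {i j : σ} (c : σ →₀ ℕ) (hc : c i = c j) :
    c.mapDomain (Equiv.swap i j) = c := by
  ext x
  obtain ⟨y, rfl⟩ := (Equiv.swap i j).surjective x
  rw [Finsupp.mapDomain_apply (Equiv.swap i j).injective, Equiv.swap_apply_def]
  split_ifs with h h <;> simp [*]

theorem exists_eq_add_single {σ : Type*} {i j : σ} (d : σ →₀ ℕ) (hij : i ≠ j) (h : d j ≤ d i) :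
    ∃ c : σ →₀ ℕ, c i = c j ∧ d = c + Finsupp.single i (d i - d j) := by
  refine ⟨d - Finsupp.single i (d i - d j), ?_, ?_⟩
  · simp [Finsupp.single_eq_of_ne hij.symm]
    omega
  · rw [tsub_add_cancel_of_le]
    intro x
    rcases eq_or_ne x i with rfl | hx
    · simp
    · simp [Finsupp.single_eq_of_ne hx]

/-- The sum of the squares of the exponents of a monomial. -/
def sqNorm {σ : Type*} [Fintype σ] (d : σ →₀ ℕ) : ℕ := ∑ j, d j ^ 2

theorem sqNorm_mapDomain {σ : Type*} [Fintype σ] (w : Equiv.Perm σ) (d : σ →₀ ℕ) :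
    sqNorm (d.mapDomain w) = sqNorm d := by
  unfold sqNorm
  rw [← Equiv.sum_comp w]
  simp [Finsupp.mapDomain_apply w.injective]

theorem sqNorm_add_single {σ : Type*} [Fintype σ] (d : σ →₀ ℕ) (i : σ) (t : ℕ) :
    sqNorm (d + Finsupp.single i t) = sqNorm d + 2 * d i * t + t ^ 2 := by
  classical
  unfold sqNorm
  rw [← Finset.add_sum_erase _ _ (Finset.mem_univ i),
    ← Finset.add_sum_erase _ (fun j => d j ^ 2) (Finset.mem_univ i)]
  have : ∑ x ∈ Finset.univ.erase i, (d + Finsupp.single i t) x ^ 2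
      = ∑ x ∈ Finset.univ.erase i, d x ^ 2 :=
    Finset.sum_congr rfl fun x hx => by simp [Finsupp.single_eq_of_ne (Finset.ne_of_mem_erase hx)]
  rw [this]
  simp
  ring

/-- The span of the monomials whose exponents have sum of squares less than `q`. -/
noncomputable def lowSpan (σ F : Type*) [Fintype σ] [CommRing F] (q : ℕ) :
    Submodule F (MvPolynomial σ F) :=
  Submodule.span F ((fun d => monomial d 1) '' {d | sqNorm d < q})

theorem monomial_mem_lowSpan {σ F : Type*} [Fintype σ] [CommRing F] {d : σ →₀ ℕ} {q : ℕ}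
    (h : sqNorm d < q) :
    monomial d (1 : F) ∈ lowSpan σ F q :=
  Submodule.subset_span ⟨d, h, rfl⟩

section DemazureAtom

variable {σ F : Type*} [CommRing F] [IsDomain F] [DecidableEq σ] {i j : σ}
  {p : MvPolynomial σ F → MvPolynomial σ F}

theorem atom_add (hij : i ≠ j)
    (hp : ∀ f, (X i - X j) * p f = X j * (f - rename (Equiv.swap i j) f)) (f g) :
    p (f + g) = p f + p g := by
  apply mul_left_cancel₀ (X_sub_X_ne_zero hij)
  rw [mul_add, hp, hp, hp, map_add]
  ring

theorem atom_smul (hij : i ≠ j)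
    (hp : ∀ f, (X i - X j) * p f = X j * (f - rename (Equiv.swap i j) f)) (c : F) (f) :
    p (c • f) = c • p f := by
  apply mul_left_cancel₀ (X_sub_X_ne_zero hij)
  rw [mul_smul_comm, hp, hp, map_smul, ← smul_sub, mul_smul_comm]

theorem atom_rename_swap (hij : i ≠ j)
    (hp : ∀ f, (X i - X j) * p f = X j * (f - rename (Equiv.swap i j) f)) (f) :
    p (rename (Equiv.swap i j) f) = - p f := by
  apply mul_left_cancel₀ (X_sub_X_ne_zero hij)
  rw [mul_neg, hp, hp, rename_rename, ← Equiv.Perm.coe_mul, Equiv.swap_mul_self,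
    Equiv.Perm.coe_one, rename_id_apply]
  ring

theorem atom_monomial (hij : i ≠ j)
    (hp : ∀ f, (X i - X j) * p f = X j * (f - rename (Equiv.swap i j) f))
    (c : σ →₀ ℕ) (hc : c i = c j) (m : ℕ) :
    p (monomial (c + Finsupp.single i m) 1) = ∑ t ∈ Finset.range m,
      monomial (c + Finsupp.single i t + Finsupp.single j (m - t)) 1 := by
  apply mul_left_cancel₀ (X_sub_X_ne_zero hij)
  have h1 : ∀ (d : σ →₀ ℕ) (k : σ) (t : ℕ),
      monomial (d + Finsupp.single k t) (1 : F) = monomial d 1 * X k ^ t := by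
    intro d k t
    rw [X_pow_eq_monomial, monomial_mul, one_mul]
  have h2 : ∑ t ∈ Finset.range m,
      monomial (c + Finsupp.single i t + Finsupp.single j (m - t)) (1 : F)
      = monomial c 1 * X j * ∑ t ∈ Finset.range m, X i ^ t * X j ^ (m - 1 - t) := by
    rw [Finset.mul_sum]
    refine Finset.sum_congr rfl fun t ht => ?_
    have : m - t = m - 1 - t + 1 := by have := Finset.mem_range.1 ht; omega
    rw [h1, h1, this, pow_succ]
    ring
  have h3 := (Commute.all (X i : MvPolynomial σ F) (X j)).geom_sum₂_mul m
  rw [hp, rename_monomial, Finsupp.mapDomain_add, mapDomain_swap_of_eq c hc,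
    Finsupp.mapDomain_single, Equiv.swap_apply_left, h2, h1, h1]
  linear_combination (-(monomial c 1 * X j)) * h3

variable [Fintype σ]

theorem atom_monomial_mem (hij : i ≠ j)
    (hp : ∀ f, (X i - X j) * p f = X j * (f - rename (Equiv.swap i j) f))
    (d : σ →₀ ℕ) (h : d j < d i) :
    p (monomial d 1) - monomial (d.mapDomain (Equiv.swap i j)) 1 ∈ lowSpan σ F (sqNorm d) := by
  obtain ⟨c, hc, hd⟩ := exists_eq_add_single d hij h.le
  obtain ⟨m, hm⟩ : ∃ m, d i - d j = m + 1 := ⟨d i - d j - 1, by omega⟩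
  rw [hm] at hd
  rw [hd, atom_monomial hij hp c hc, Finset.sum_range_succ', Finsupp.mapDomain_add,
    mapDomain_swap_of_eq c hc, Finsupp.mapDomain_single, Equiv.swap_apply_left]
  simp only [Finsupp.single_zero, add_zero, tsub_zero, add_sub_cancel_right]
  refine Submodule.sum_mem _ fun t ht => monomial_mem_lowSpan ?_
  obtain ⟨s, rfl⟩ : ∃ s, m = t + 1 + s := Nat.exists_eq_add_of_lt (Finset.mem_range.1 ht) |>.imp
    fun s hs => by omega
  rw [sqNorm_add_single, sqNorm_add_single, sqNorm_add_single,
    show t + 1 + s + 1 - (t + 1) = s + 1 by omega]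
  simp only [Finsupp.add_apply, Finsupp.single_eq_of_ne hij.symm, hc]
  nlinarith

theorem atom_mem_lowSpan (hij : i ≠ j)
    (hp : ∀ f, (X i - X j) * p f = X j * (f - rename (Equiv.swap i j) f))
    {q : ℕ} {f : MvPolynomial σ F} (hf : f ∈ lowSpan σ F q) : p f ∈ lowSpan σ F q := by
  have main : ∀ d : σ →₀ ℕ, sqNorm d < q → d j ≤ d i → p (monomial d 1) ∈ lowSpan σ F q := by
    intro d hd h
    rcases h.eq_or_lt with h | h
    · have := atom_monomial hij hp d h.symm 0
      simp only [Finsupp.single_zero, add_zero, Finset.range_zero, Finset.sum_empty] at this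
      rw [this]
      exact zero_mem _
    · rw [← sub_add_cancel (p (monomial d 1)) (monomial (d.mapDomain (Equiv.swap i j)) 1)]
      refine add_mem (Submodule.span_mono (Set.image_mono fun e he => ?_)
        (atom_monomial_mem hij hp d h)) (monomial_mem_lowSpan (by rwa [sqNorm_mapDomain]))
      exact lt_trans he hd
  induction hf using Submodule.span_induction with
  | mem f hf =>
    obtain ⟨d, hd, rfl⟩ := hf
    rcases le_total (d j) (d i) with h | h
    · exact main d hd h
    · have := main (d.mapDomain (Equiv.swap i j)) (by rwa [sqNorm_mapDomain]) (by
        have h1 := Finsupp.mapDomain_apply (Equiv.swap i j).injective d i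
        have h2 := Finsupp.mapDomain_apply (Equiv.swap i j).injective d j
        rw [Equiv.swap_apply_left] at h1
        rw [Equiv.swap_apply_right] at h2
        omega)
      rw [← rename_monomial, atom_rename_swap hij hp] at this
      exact neg_mem_iff.1 this
  | zero =>
    have := atom_smul hij hp 0 0
    rw [zero_smul, zero_smul] at this
    rw [this]
    exact zero_mem _
  | add f g _ _ hf hg =>
    rw [atom_add hij hp]
    exact add_mem hf hg
  | smul c f _ hf =>
    rw [atom_smul hij hp]
    exact Submodule.smul_mem _ _ hf
end DemazureAtom

theorem sw_val {n i : ℕ} (hi : i + 1 < n) (x : Fin n) :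
    (sw n i x : ℕ) = if (x : ℕ) = i then i + 1 else if (x : ℕ) = i + 1 then i else x := by
  rw [sw, dif_pos hi, Equiv.swap_apply_def]
  simp only [Fin.ext_iff]
  split_ifs <;> rfl

theorem invNum_one (n : ℕ) : invNum (1 : Equiv.Perm (Fin n)) = 0 := by
  rw [invNum, Finset.card_eq_zero, Finset.filter_eq_empty_iff]
  exact fun p _ h => lt_asymm h.1 h.2

theorem invNum_sw_mul_le {n i : ℕ} (hi : i + 1 < n) (u : Equiv.Perm (Fin n)) :
    invNum (sw n i * u) ≤ invNum u + 1 := by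
  refine le_trans (Finset.card_le_card (t := insert
    (u⁻¹ ⟨i, Nat.lt_of_succ_lt hi⟩, u⁻¹ ⟨i + 1, hi⟩) _) fun p hp => ?_) (Finset.card_insert_le _ _)
  simp only [Finset.mem_filter, Finset.mem_univ, true_and, Finset.mem_insert, Prod.ext_iff,
    Equiv.Perm.mul_apply, Equiv.Perm.eq_inv_iff_eq, Fin.ext_iff, Fin.lt_def, sw_val hi] at hp ⊢
  split_ifs at hp <;> omega

theorem inv_lt_inv_of_invNum_lt {n i : ℕ} (hi : i + 1 < n) (u : Equiv.Perm (Fin n))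
    (h : invNum u < invNum (sw n i * u)) :
    u⁻¹ ⟨i, Nat.lt_of_succ_lt hi⟩ < u⁻¹ ⟨i + 1, hi⟩ := by
  by_contra hlt
  refine h.not_ge (Finset.card_le_card fun p hp => ?_)
  have : p ≠ (u⁻¹ ⟨i, Nat.lt_of_succ_lt hi⟩, u⁻¹ ⟨i + 1, hi⟩) := by
    rintro rfl
    exact hlt (Finset.mem_filter.1 hp).2.1
  simp only [Finset.mem_filter, Finset.mem_univ, true_and, ne_eq, Prod.ext_iff,
    Equiv.Perm.mul_apply, Equiv.Perm.eq_inv_iff_eq, Fin.ext_iff, Fin.lt_def, sw_val hi] at hp this ⊢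
  split_ifs at hp <;> omega

theorem sw_mul_lt_of_lt {n i : ℕ} (hi : i + 1 < n) (u : Equiv.Perm (Fin n))
    (h : u⁻¹ ⟨i, Nat.lt_of_succ_lt hi⟩ < u⁻¹ ⟨i + 1, hi⟩) {p q : Fin n} (hpq : p < q)
    (hu : u q < u p) : (sw n i * u) q < (sw n i * u) p := by
  have : ¬ (q = u⁻¹ ⟨i, Nat.lt_of_succ_lt hi⟩ ∧ p = u⁻¹ ⟨i + 1, hi⟩) := by
    rintro ⟨rfl, rfl⟩
    exact lt_asymm h hpq
  simp only [Equiv.Perm.mul_apply, Equiv.Perm.eq_inv_iff_eq, Fin.ext_iff, Fin.lt_def,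
    sw_val hi] at hu this ⊢
  split_ifs <;> omega

theorem invNum_prod_le {n : ℕ} (l : List ℕ) (hl : ∀ i ∈ l, i + 1 < n) :
    invNum (l.map (sw n)).prod ≤ l.length := by
  induction l with
  | nil => simp [invNum_one]
  | cons i l ih =>
    rw [List.map_cons, List.prod_cons, List.length_cons]
    exact (invNum_sw_mul_le (hl i (by simp)) _).trans
      (Nat.succ_le_succ (ih fun j hj => hl j (by simp [hj])))

theorem foldr_atom_monomial {n : ℕ} {F : Type*} [CommRing F] [IsDomain F]
    {P : ℕ → MvPolynomial (Fin n) F → MvPolynomial (Fin n) F}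
    (hP : ∀ (i : ℕ) (hi : i + 1 < n) (f : MvPolynomial (Fin n) F),
      (X (⟨i, Nat.lt_of_succ_lt hi⟩ : Fin n) - X ⟨i + 1, hi⟩) * P i f
        = X ⟨i + 1, hi⟩ * (f - rename (sw n i) f))
    (e : Fin n →₀ ℕ) (l : List ℕ) (hl : ∀ i ∈ l, i + 1 < n)
    (hlen : l.length = invNum (l.map (sw n)).prod)
    (he : ∀ p q, p < q → (l.map (sw n)).prod q < (l.map (sw n)).prod p → e q < e p) :
    l.foldr P (monomial e 1) - monomial (e.mapDomain (l.map (sw n)).prod) 1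
      ∈ lowSpan (Fin n) F (sqNorm e) := by
  induction l with
  | nil => simp
  | cons i l ih =>
    have hi : i + 1 < n := hl i (by simp)
    have hl' : ∀ j ∈ l, j + 1 < n := fun j hj => hl j (by simp [hj])
    rw [List.map_cons, List.prod_cons] at hlen he ⊢
    rw [List.foldr_cons]
    set u := (l.map (sw n)).prod with hu
    have hle : invNum u ≤ l.length := invNum_prod_le l hl'
    have hle' := invNum_sw_mul_le hi u
    rw [List.length_cons] at hlen
    have hlt := inv_lt_inv_of_invNum_lt hi u (by omega)
    have ih := ih hl' (by omega) fun p q hpq h => he p q hpq (sw_mul_lt_of_lt hi u hlt hpq h)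
    have hswap : sw n i = Equiv.swap ⟨i, Nat.lt_of_succ_lt hi⟩ ⟨i + 1, hi⟩ := dif_pos hi
    have hPi := hP i hi
    rw [hswap] at hPi he ⊢
    have hij : (⟨i, Nat.lt_of_succ_lt hi⟩ : Fin n) ≠ ⟨i + 1, hi⟩ := by simp
    have hd : (e.mapDomain u) ⟨i + 1, hi⟩ < (e.mapDomain u) ⟨i, Nat.lt_of_succ_lt hi⟩ := by
      have h1 := Finsupp.mapDomain_apply u.injective e
      have := he _ _ hlt (by simp [Fin.lt_def])
      rw [← h1, ← h1] at this
      simpa using this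
    have h1 := atom_monomial_mem hij hPi _ hd
    have h2 := atom_mem_lowSpan hij hPi ih
    rw [sqNorm_mapDomain, ← Finsupp.mapDomain_comp, ← Equiv.Perm.coe_mul] at h1
    convert add_mem h2 h1 using 1
    have h3 := atom_add hij hPi (l.foldr P (monomial e 1) - monomial (e.mapDomain u) 1)
      (monomial (e.mapDomain u) 1)
    rw [sub_add_cancel] at h3
    rw [h3]
    ring

theorem exists_permDes_of_lt {n : ℕ} (w : Equiv.Perm (Fin n)) {p q : Fin n} (hpq : p < q)
    (h : w q < w p) : ∃ i ∈ permDes w, (p : ℕ) ≤ i ∧ i < q := by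
  by_contra! hcon
  have : ∀ r, (p : ℕ) ≤ r → r ≤ q → pval w p ≤ pval w r := by
    intro r hr
    induction r, hr using Nat.le_induction with
    | base => exact fun _ => le_rfl
    | succ r hr ih =>
      intro hrq
      refine (ih (by omega)).trans ?_
      by_contra! hlt
      have := hcon r (Finset.mem_filter.2 ⟨Finset.mem_range.2 (by omega), hlt⟩) hr
      omega
  have := this q hpq.le le_rfl
  simp only [pval, Fin.is_lt, dif_pos, Fin.eta] at this
  omega

theorem expI_lt_expI {n : ℕ} (w : Equiv.Perm (Fin n)) {p q : Fin n} (hpq : p < q)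
    (h : w q < w p) : expI n (permDes w) q < expI n (permDes w) p := by
  obtain ⟨i, hi, hpi, hiq⟩ := exists_permDes_of_lt w hpq h
  refine Finset.card_lt_card ⟨fun k hk => ?_, fun hsub => ?_⟩
  · rw [Finset.mem_filter] at hk ⊢
    exact ⟨hk.1, by omega⟩
  · have := hsub (Finset.mem_filter.2 ⟨hi, hpi⟩)
    rw [Finset.mem_filter] at this
    omega

theorem xI_eq_monomial (R : Type*) [CommRing R] (n : ℕ) (I : Finset ℕ) :
    xI R n I = monomial (Finsupp.equivFunOnFinite.symm (expI n I)) 1 := by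
  rw [monomial_eq, C_1, one_mul, Finsupp.prod_fintype _ _ (by simp)]
  rfl

theorem sum_le_sum_of_card_eq {ι : Type*} [DecidableEq ι] {f : ι → ℕ} {S T : Finset ι}
    (hcard : T.card = S.card) (hf : ∀ a ∈ S, ∀ b ∉ S, f b ≤ f a) :
    ∑ x ∈ T, f x ≤ ∑ x ∈ S, f x := by
  rw [← Finset.sum_sdiff_le_sum_sdiff]
  let e := Finset.equivOfCardEq (Finset.card_sdiff_comm hcard)
  rw [← Finset.sum_coe_sort, ← Finset.sum_coe_sort (S \ T), ← Equiv.sum_comp e]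
  exact Finset.sum_le_sum fun x _ =>
    hf _ (Finset.mem_sdiff.1 (e x).2).1 _ (Finset.mem_sdiff.1 x.2).2

theorem sum_lt_sum_of_card_eq {ι : Type*} [DecidableEq ι] {f : ι → ℕ} {S T : Finset ι}
    (hcard : T.card = S.card) (hne : T ≠ S) (hf : ∀ a ∈ S, ∀ b ∉ S, f b < f a) :
    ∑ x ∈ T, f x < ∑ x ∈ S, f x := by
  rw [← Finset.sum_sdiff_lt_sum_sdiff]
  let e := Finset.equivOfCardEq (Finset.card_sdiff_comm hcard)
  rw [← Finset.sum_coe_sort, ← Finset.sum_coe_sort (S \ T), ← Equiv.sum_comp e]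
  have hT : (T \ S).Nonempty := Finset.sdiff_nonempty.2 fun h =>
    hne (Finset.eq_of_subset_of_card_le h hcard.ge)
  have : Nonempty ↥(T \ S) := hT.to_subtype
  exact Finset.sum_lt_sum_of_nonempty Finset.univ_nonempty fun x _ =>
    hf _ (Finset.mem_sdiff.1 (e x).2).1 _ (Finset.mem_sdiff.1 x.2).2

theorem sum_add_ite_sq {ι : Type*} [Fintype ι] [DecidableEq ι] (f : ι → ℕ) (S : Finset ι) (c : ℕ) :
    ∑ j, (f j + if j ∈ S then c else 0) ^ 2
      = ∑ j, f j ^ 2 + 2 * c * ∑ j ∈ S, f j + S.card * c ^ 2 := by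
  have h : ∀ j, (f j + if j ∈ S then c else 0) ^ 2
      = f j ^ 2 + if j ∈ S then 2 * c * f j + c ^ 2 else 0 := fun j => by
    split_ifs <;> ring
  simp_rw [h, Finset.sum_add_distrib, Finset.sum_ite_mem, Finset.univ_inter,
    Finset.sum_add_distrib, Finset.mul_sum, Finset.sum_const, smul_eq_mul, add_assoc]

/-- Values ordering the variables by exponent, ties being broken in favour of small indices. -/
def tieKey {n : ℕ} (d : Fin n →₀ ℕ) (j : Fin n) : ℕ := n * d j + (n - 1 - j)

theorem tieKey_injective {n : ℕ} (d : Fin n →₀ ℕ) : Function.Injective (tieKey d) := by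
  intro x y h
  have h' := congrArg (· % n) h
  simp only [tieKey, Nat.mul_add_mod] at h'
  rw [Nat.mod_eq_of_lt (by omega), Nat.mod_eq_of_lt (by omega)] at h'
  omega

theorem le_of_tieKey_lt {n : ℕ} {d : Fin n →₀ ℕ} {x y : Fin n} (h : tieKey d x < tieKey d y) :
    d x ≤ d y := by
  by_contra! hlt
  have : n * d y + n ≤ n * d x := by nlinarith
  unfold tieKey at h
  omega

/-- The exponent vector of `∏ i ∈ S, X i`. -/
noncomputable def indicatorExp {σ : Type*} (S : Finset σ) : σ →₀ ℕ := ∑ i ∈ S, Finsupp.single i 1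

theorem indicatorExp_apply {σ : Type*} [DecidableEq σ] (S : Finset σ) (j : σ) :
    indicatorExp S j = if j ∈ S then 1 else 0 := by
  simp [indicatorExp, Finsupp.finsetSum_apply, Finsupp.single_apply]

theorem sqNorm_add_indicatorExp {σ : Type*} [Fintype σ] [DecidableEq σ] (d : σ →₀ ℕ)
    (S : Finset σ) :
    sqNorm (d + indicatorExp S) = sqNorm d + 2 * ∑ j ∈ S, d j + S.card := by
  simp_rw [sqNorm, Finsupp.add_apply, indicatorExp_apply, sum_add_ite_sq]
  simp

theorem tieKey_add_indicatorExp {n : ℕ} (d : Fin n →₀ ℕ) (S : Finset (Fin n)) (j : Fin n) :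
    tieKey (d + indicatorExp S) j = tieKey d j + if j ∈ S then n else 0 := by
  simp only [tieKey, Finsupp.add_apply, indicatorExp_apply]
  split_ifs <;> ring

theorem expI_eq_succ {n k : ℕ} (hk : k + 1 < n) (I : Finset ℕ) :
    expI n I ⟨k, Nat.lt_of_succ_lt hk⟩ = expI n I ⟨k + 1, hk⟩ + if k ∈ I then 1 else 0 := by
  unfold expI
  have h : I.filter (k ≤ ·) = I.filter (k + 1 ≤ ·) ∪ I.filter (k = ·) := by
    ext x
    simp only [Finset.mem_union, Finset.mem_filter]
    grind
  have hd : Disjoint (I.filter (k + 1 ≤ ·)) (I.filter (k = ·)) :=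
    Finset.disjoint_filter.2 fun x _ h1 h2 => by omega
  rw [h, Finset.card_union_of_disjoint hd, Finset.filter_eq]
  split_ifs <;> simp

theorem exists_perm_tieKey_lt {n : ℕ} (d : Fin n →₀ ℕ) :
    ∃ w : Equiv.Perm (Fin n), ∀ i j, i < j → tieKey d (w j) < tieKey d (w i) := by
  let f : Fin n → ℕᵒᵈ := fun j => OrderDual.toDual (tieKey d j)
  refine ⟨Tuple.sort f, fun i j hij => lt_of_le_of_ne (Tuple.monotone_sort f hij.le) fun h => ?_⟩
  exact hij.ne ((Tuple.sort f).injective (tieKey_injective d h)).symm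

theorem descent_or_reducible {n : ℕ} (d : Fin n →₀ ℕ) :
    (∃ w : Equiv.Perm (Fin n), ∀ j, d (w j) = expI n (permDes w) j) ∨
    ∃ S : Finset (Fin n), S.Nonempty ∧ (∀ a ∈ S, 1 ≤ d a) ∧
      ∀ a ∈ S, ∀ b ∉ S, tieKey d b + n < tieKey d a := by
  obtain ⟨w, hw⟩ := exists_perm_tieKey_lt d
  have hle : ∀ i j, i ≤ j → tieKey d (w j) ≤ tieKey d (w i) := fun i j hij =>
    hij.eq_or_lt.elim (fun h => h ▸ le_rfl) fun h => (hw i j h).le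
  by_cases hex : ∃ i, 1 ≤ d (w i) ∧ ∀ j, i < j → tieKey d (w j) + n < tieKey d (w i)
  · right
    obtain ⟨i, hi, hgap⟩ := hex
    refine ⟨(Finset.Iic i).image w, ⟨w i, by simp⟩, ?_, ?_⟩
    · simp only [Finset.forall_mem_image, Finset.mem_Iic]
      intro k hk
      rcases hk.eq_or_lt with rfl | hk
      · exact hi
      · exact hi.trans (le_of_tieKey_lt (hw k i hk))
    · simp only [Finset.forall_mem_image, Finset.mem_Iic]
      intro k hk b hb
      obtain ⟨j, rfl⟩ := w.surjective b
      have hj : i < j := by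
        by_contra! hji
        exact hb (Finset.mem_image_of_mem w (Finset.mem_Iic.2 hji))
      exact (hgap j hj).trans_le (hle k i hk)
  · left
    push Not at hex
    refine ⟨w, ?_⟩
    suffices H : ∀ m k (hk : k < n), k + 1 + m = n → d (w ⟨k, hk⟩) = expI n (permDes w) ⟨k, hk⟩ by
      exact fun j => H (n - 1 - j) j j.2 (by omega)
    intro m
    induction m with
    | zero =>
      intro k hk hkn
      have hz : expI n (permDes w) ⟨k, hk⟩ = 0 := by
        rw [expI, Finset.card_eq_zero, Finset.filter_eq_empty_iff]
        intro x hx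
        have := Finset.mem_range.1 (Finset.mem_filter.1 hx).1
        simp only
        omega
      rw [hz]
      by_contra hne
      obtain ⟨j, hj, -⟩ := hex ⟨k, hk⟩ (by omega)
      rw [Fin.lt_def] at hj
      simp only at hj
      omega
    | succ m ih =>
      intro k hk hkn
      have hk' : k + 1 < n := by omega
      have hdes : k ∈ permDes w ↔ w ⟨k + 1, hk'⟩ < w ⟨k, hk⟩ := by
        rw [permDes, Finset.mem_filter, Finset.mem_range, pval, pval, dif_pos hk, dif_pos hk',
          Fin.lt_def]
        omega
      rw [expI_eq_succ hk', ← ih (k + 1) hk' (by omega)]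
      have hlt := hw ⟨k, hk⟩ ⟨k + 1, hk'⟩ (by simp [Fin.lt_def])
      have hgap : tieKey d (w ⟨k, hk⟩) ≤ tieKey d (w ⟨k + 1, hk'⟩) + n := by
        by_cases hz : d (w ⟨k, hk⟩) = 0
        · rw [tieKey, hz]
          omega
        · obtain ⟨j, hj, hle'⟩ := hex ⟨k, hk⟩ (by omega)
          refine hle'.trans (Nat.add_le_add_right (hle _ _ ?_) _)
          rw [Fin.lt_def] at hj
          rw [Fin.le_def]
          exact hj
      have hne : w ⟨k, hk⟩ ≠ w ⟨k + 1, hk'⟩ := w.injective.ne (by simp)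
      simp only [hdes]
      have hmono := le_of_tieKey_lt hlt
      unfold tieKey at hlt hgap
      generalize w ⟨k, hk⟩ = x at *
      generalize w ⟨k + 1, hk'⟩ = y at *
      rw [ne_eq, Fin.ext_iff] at hne
      obtain ⟨t, ht⟩ := Nat.exists_eq_add_of_le hmono
      rw [ht, mul_add] at hlt hgap
      rw [ht]
      have ht1 : t ≤ 1 := by
        by_contra! h2
        have : n * 2 ≤ n * t := Nat.mul_le_mul_left n h2
        omega
      simp only [Fin.lt_def]
      interval_cases t <;> split_ifs <;> omega

theorem monomial_mem_of_descent {n : ℕ} {R : Type*} [CommRing R]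
    {M : Submodule (symmetricSubalgebra (Fin n) R) (MvPolynomial (Fin n) R)}
    (hM : ∀ (w : Equiv.Perm (Fin n)) (d : Fin n →₀ ℕ), (∀ j, d (w j) = expI n (permDes w) j) →
      ∃ f ∈ M, f - monomial d 1 ∈ lowSpan (Fin n) R (sqNorm d)) (d : Fin n →₀ ℕ) :
    monomial d 1 ∈ M := by
  induction d using (InvImage.wf (fun d : Fin n →₀ ℕ => toLex (sqNorm d, ∑ j, tieKey d j ^ 2))
    wellFounded_lt).induction with
  | _ d ih =>
  simp only [InvImage, Prod.Lex.toLex_lt_toLex] at ih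
  obtain ⟨w, hw⟩ | ⟨S, hS, hpos, hgap⟩ := descent_or_reducible d
  · obtain ⟨f, hf, hlow⟩ := hM w d hw
    have hle : lowSpan (Fin n) R (sqNorm d) ≤ M.restrictScalars R := by
      refine Submodule.span_le.2 ?_
      rintro _ ⟨e, he, rfl⟩
      exact ih e (Or.inl he)
    have := M.sub_mem hf (hle hlow)
    rwa [sub_sub_cancel] at this
  · obtain ⟨c, rfl⟩ : ∃ c, d = c + indicatorExp S := by
      refine ⟨d - indicatorExp S, (tsub_add_cancel_of_le fun x => ?_).symm⟩
      rw [indicatorExp_apply]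
      split_ifs with h
      exacts [hpos x h, Nat.zero_le _]
    have hkey : ∀ a ∈ S, ∀ b ∉ S, tieKey c b < tieKey c a := by
      intro a ha b hb
      have := hgap a ha b hb
      rw [tieKey_add_indicatorExp, tieKey_add_indicatorExp, if_pos ha, if_neg hb] at this
      omega
    have hcM : monomial c 1 ∈ M := ih c <| Or.inl <| by
      rw [sqNorm_add_indicatorExp]
      have := hS.card_pos
      omega
    have hprod : esymm (Fin n) R S.card * monomial c 1
        = ∑ T ∈ Finset.powersetCard S.card Finset.univ, monomial (c + indicatorExp T) 1 := by
      rw [esymm_eq_sum_monomial, Finset.sum_mul]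
      refine Finset.sum_congr rfl fun T _ => ?_
      rw [monomial_mul, one_mul, add_comm, indicatorExp]
    have hmem : esymm (Fin n) R S.card * monomial c 1 ∈ M :=
      M.smul_mem ⟨esymm (Fin n) R S.card, esymm_isSymmetric _ _ _⟩ hcM
    rw [hprod, ← Finset.add_sum_erase _ _
      (Finset.mem_powersetCard.2 ⟨Finset.subset_univ S, rfl⟩)] at hmem
    refine (M.add_mem_iff_left (M.sum_mem fun T hT => ih _ ?_)).1 hmem
    obtain ⟨hTS, hT⟩ := Finset.mem_erase.1 hT
    have hcard := (Finset.mem_powersetCard.1 hT).2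
    have h1 := sum_le_sum_of_card_eq hcard fun a ha b hb => le_of_tieKey_lt (hkey a ha b hb)
    have h2 := sum_lt_sum_of_card_eq hcard hTS hkey
    have hn : 0 < n := by
      obtain ⟨x, -⟩ := hS
      exact x.pos
    simp_rw [tieKey_add_indicatorExp, sum_add_ite_sq, sqNorm_add_indicatorExp, hcard]
    rcases h1.eq_or_lt with h1 | h1
    · right
      refine ⟨by rw [h1], ?_⟩
      gcongr
    · left
      omega

/-- The action of the permutations of `σ` on polynomials by renaming the variables. -/
noncomputable abbrev renamePermAction (σ R : Type*) [CommRing R] :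
    MulSemiringAction (Equiv.Perm σ) (MvPolynomial σ R) where
  smul g f := rename g f
  one_smul f := rename_id_apply f
  mul_smul g h f := (rename_rename h g f).symm
  smul_zero g := map_zero (rename g)
  smul_add g := map_add (rename g)
  smul_one g := map_one (rename g)
  smul_mul g := map_mul (rename g)

theorem finrank_symmetricSubalgebra (σ R : Type*) [Fintype σ] [CommRing R] [IsDomain R] :
    Module.finrank (symmetricSubalgebra σ R) (MvPolynomial σ R)
      = Nat.card (Equiv.Perm σ) := by
  let := renamePermAction σ R
  have smul_def (g : Equiv.Perm σ) (f : MvPolynomial σ R) : g • f = rename g f := rfl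
  have : IsGaloisGroup (Equiv.Perm σ) (symmetricSubalgebra σ R) (MvPolynomial σ R) :=
    { faithful := ⟨fun {g h} H => Equiv.ext fun i => by
        have := H (X i)
        simpa [smul_def, X_injective.eq_iff] using this⟩
      commutes := ⟨fun g s f => by
        rw [smul_def, smul_def, Algebra.smul_def, Algebra.smul_def, map_mul]
        congr 1
        exact s.2 g⟩
      isInvariant := ⟨fun b hb => ⟨⟨b, hb⟩, rfl⟩⟩ }
  exact (IsGaloisGroup.card_eq_finrank' (Equiv.Perm σ) (symmetricSubalgebra σ R)
    (MvPolynomial σ R)).symm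

theorem linearIndependent_of_span_symmetricSubalgebra {σ R : Type*} [Fintype σ] [DecidableEq σ]
    [CommRing R] [IsDomain R] {a : Equiv.Perm σ → MvPolynomial σ R}
    (h : ⊤ ≤ Submodule.span (symmetricSubalgebra σ R) (Set.range a)) :
    LinearIndependent (symmetricSubalgebra σ R) a :=
  linearIndependent_of_top_le_span_of_card_eq_finrank h <| by
    rw [finrank_symmetricSubalgebra, Nat.card_eq_fintype_card]

theorem coinv_basis_of_span {n : ℕ} {F : Type*} [Field F]
    {a : Equiv.Perm (Fin n) → MvPolynomial (Fin n) F}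
    (h : Submodule.span (symmetricSubalgebra (Fin n) F) (Set.range a) = ⊤) :
    LinearIndependent F (fun w => Ideal.Quotient.mk (coinvIdeal n F) (a w)) ∧
    Submodule.span F (Set.range fun w => Ideal.Quotient.mk (coinvIdeal n F) (a w)) = ⊤ := by
  have coord (f : MvPolynomial (Fin n) F) :
      ∃ c : Equiv.Perm (Fin n) → symmetricSubalgebra (Fin n) F, ∑ w, c w • a w = f :=
    (Submodule.mem_span_range_iff_exists_fun _).1 (h ▸ Submodule.mem_top)
  have hli := linearIndependent_of_span_symmetricSubalgebra h.ge
  constructor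
  · rw [Fintype.linearIndependent_iff]
    intro c hc w
    have hmem : ∑ w, c w • a w ∈ coinvIdeal n F := by
      rw [← Ideal.Quotient.eq_zero_iff_mem, ← hc, map_sum]
      rfl
    have key : ∀ f ∈ coinvIdeal n F, ∃ r : Equiv.Perm (Fin n) → symmetricSubalgebra (Fin n) F,
        (∀ w, constantCoeff (r w).1 = 0) ∧ ∑ w, r w • a w = f := by
      intro f hf
      rw [coinvIdeal] at hf
      induction hf using Submodule.span_induction with
      | mem f hf =>
        obtain ⟨r, hr⟩ := coord 1
        refine ⟨fun w => ⟨f, hf.1⟩ * r w, fun w => ?_, ?_⟩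
        · simp [hf.2]
        · simp_rw [mul_smul, ← Finset.smul_sum, hr, Subalgebra.smul_def, smul_eq_mul, mul_one]
      | zero => exact ⟨0, by simp, by simp⟩
      | add f g _ _ hf hg =>
        obtain ⟨r, hr, rfl⟩ := hf
        obtain ⟨s, hs, rfl⟩ := hg
        exact ⟨r + s, fun w => by simp [hr, hs], by simp [add_smul, Finset.sum_add_distrib]⟩
      | smul g f _ hf =>
        obtain ⟨r, hr, rfl⟩ := hf
        choose s hs using fun w => coord (g * a w)
        refine ⟨fun v => ∑ w, r w * s w v, fun w => ?_, ?_⟩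
        · simp [hr]
        · simp_rw [Finset.sum_smul, smul_eq_mul, Finset.mul_sum]
          rw [Finset.sum_comm]
          refine Finset.sum_congr rfl fun w _ => ?_
          simp_rw [mul_smul, ← Finset.smul_sum, hs, Subalgebra.smul_def, smul_eq_mul]
          ring
    obtain ⟨r, hr, hrc⟩ := key _ hmem
    have hz := Fintype.linearIndependent_iff.1 hli
      (fun w => r w - algebraMap F _ (c w)) (by
        simp_rw [sub_smul, Finset.sum_sub_distrib, algebraMap_smul, hrc, sub_self]) w
    have h2 := congrArg (fun s => constantCoeff s.1) hz
    simpa [hr] using h2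
  · rw [eq_top_iff]
    rintro x -
    obtain ⟨f, rfl⟩ := Ideal.Quotient.mk_surjective x
    obtain ⟨c, rfl⟩ := coord f
    rw [map_sum]
    refine Submodule.sum_mem _ fun w _ => ?_
    have : Ideal.Quotient.mk (coinvIdeal n F) (c w • a w)
        = constantCoeff (c w).1 • Ideal.Quotient.mk (coinvIdeal n F) (a w) := by
      rw [← Ideal.Quotient.mkₐ_eq_mk F, ← map_smul, Ideal.Quotient.mkₐ_eq_mk, Ideal.Quotient.eq,
        Subalgebra.smul_def, smul_eq_mul, MvPolynomial.smul_eq_C_mul, ← sub_mul]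
      refine Ideal.mul_mem_right _ _ (Ideal.subset_span ⟨?_, by simp⟩)
      exact (c w).2.sub (IsSymmetric.C _)
    rw [this]
    exact Submodule.smul_mem _ _ (Submodule.subset_span ⟨w, rfl⟩)

/-- **Part of Theorem 4.4.**  The images of the Demazure atoms `π̄_w(x_{D(w)})` (here
`a w = π̄_{i_1} ∘ ⋯ ∘ π̄_{i_k} (x_{D(w)})` for a reduced word `w = s_{i_1} ⋯ s_{i_k}`, where
the Demazure operators `π_i` are characterized by
`(x_i - x_{i+1}) π_i f = x_i f - x_{i+1} s_i(f)` and `π̄_i = π_i - 1`) form an `F`-basis of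
the coinvariant algebra `F[x]/(F[x]^{𝔖_n}_+)`. -/
theorem stmt_4 (n : ℕ) (hn : 1 ≤ n) (F : Type*) [Field F]
    (dem : ℕ → MvPolynomial (Fin n) F → MvPolynomial (Fin n) F)
    (hdem : ∀ (i : ℕ) (hi : i + 1 < n) (f : MvPolynomial (Fin n) F),
      (X (⟨i, Nat.lt_of_succ_lt hi⟩ : Fin n) - X ⟨i + 1, hi⟩) * dem i f
        = X (⟨i, Nat.lt_of_succ_lt hi⟩ : Fin n) * f - X ⟨i + 1, hi⟩ * rename (sw n i) f)
    (a : Equiv.Perm (Fin n) → MvPolynomial (Fin n) F)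
    (ha : ∀ w : Equiv.Perm (Fin n), ∃ l : List ℕ,
      (∀ i ∈ l, i + 1 < n) ∧ (l.map (sw n)).prod = w ∧ l.length = invNum w ∧
      a w = l.foldr (fun i f => dem i f - f) (xI F n (permDes w))) :
    LinearIndependent F (fun w => Ideal.Quotient.mk (coinvIdeal n F) (a w)) ∧
    Submodule.span F
      (Set.range fun w => Ideal.Quotient.mk (coinvIdeal n F) (a w)) = ⊤ := by
  have hP : ∀ (i : ℕ) (hi : i + 1 < n) (f : MvPolynomial (Fin n) F),
      (X (⟨i, Nat.lt_of_succ_lt hi⟩ : Fin n) - X ⟨i + 1, hi⟩) * (dem i f - f)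
        = X ⟨i + 1, hi⟩ * (f - rename (sw n i) f) := by
    intro i hi f
    rw [mul_sub, hdem i hi f]
    ring
  refine coinv_basis_of_span (eq_top_iff.2 fun f _ => ?_)
  rw [f.as_sum]
  refine Submodule.sum_mem _ fun d _ => ?_
  have hd := monomial_mem_of_descent (R := F)
    (M := Submodule.span (symmetricSubalgebra (Fin n) F) (Set.range a)) ?_ d
  · have := Submodule.smul_mem _ (algebraMap F (symmetricSubalgebra (Fin n) F) (coeff d f)) hd
    rwa [algebraMap_smul, smul_monomial, smul_eq_mul, mul_one] at this
  · intro w d hdw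
    refine ⟨a w, Submodule.subset_span ⟨w, rfl⟩, ?_⟩
    obtain ⟨l, hl, rfl, hlen, haw⟩ := ha w
    set w := (l.map (sw n)).prod
    have he : d = (Finsupp.equivFunOnFinite.symm (expI n (permDes w))).mapDomain w := by
      ext x
      obtain ⟨j, rfl⟩ := w.surjective x
      rw [hdw, Finsupp.mapDomain_apply w.injective]
      rfl
    rw [haw, xI_eq_monomial, he, sqNorm_mapDomain]
    exact foldr_atom_monomial hP _ l hl hlen fun p q hpq h => expI_lt_expI w hpq h
end
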